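/- arXiv:2111.05749 — 4 statements merged into one kernel-verified Lean document; each statement's English description precedes it below -/
import Mathlib

section
/- Let p be a prime, A ∈ ℤ^{m×n}, b ∈ ℤ^m, and P := {x ∈ ℝ^n : Ax ≤ b}. Then the following statements are equivalent: (1) the system Ax ≤ b is totally dual p-adic; (2) for every nonempty face F of P, the rows of A_F form a p-adic generating set for a cone; (3) for every nonempty face F of P, the rows of A_F form a p-adic generating set for a subspace. -/
open Finset

attribute [local instance] Classical.propDecidable

/-- A real number is `p`-adic if it has the form `a / p^k` for integers `a, k`, `k ≥ 0`. -/
def IsPadic (p : ℕ) (r : ℝ) : Prop := ∃ (a : ℤ) (k : ℕ), r = (a : ℝ) / (p : ℝ) ^ k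

/-- A finite family of integral vectors is a `p`-adic generating set for a cone if every
integral vector in its conic hull is a conic combination of the vectors with `p`-adic
coefficients. -/
def IsPGSC (p : ℕ) {ι d : Type} [Fintype ι] [Fintype d] (a : ι → d → ℤ) : Prop :=
  ∀ w : d → ℤ,
    (∃ lam : ι → ℝ, (∀ i, 0 ≤ lam i) ∧ ∀ j, ∑ i, lam i * (a i j : ℝ) = (w j : ℝ)) →
    ∃ lam : ι → ℝ, (∀ i, 0 ≤ lam i) ∧ (∀ i, IsPadic p (lam i)) ∧
      ∀ j, ∑ i, lam i * (a i j : ℝ) = (w j : ℝ)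

/-- A finite family of integral vectors is a `p`-adic generating set for a subspace if every
integral vector in its linear hull is a linear combination of the vectors with `p`-adic
coefficients. -/
def IsPGSS (p : ℕ) {ι d : Type} [Fintype ι] [Fintype d] (a : ι → d → ℤ) : Prop :=
  ∀ w : d → ℤ,
    (∃ lam : ι → ℝ, ∀ j, ∑ i, lam i * (a i j : ℝ) = (w j : ℝ)) →
    ∃ lam : ι → ℝ, (∀ i, IsPadic p (lam i)) ∧
      ∀ j, ∑ i, lam i * (a i j : ℝ) = (w j : ℝ)

/-- `F` is a face of `P`: the intersection of `P` with a supporting hyperplane (this includes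
`P` itself, via `c = 0, δ = 0`). -/
def IsFace {d : Type} [Fintype d] (P F : Set (d → ℝ)) : Prop :=
  ∃ (c : d → ℝ) (δ : ℝ), (∀ x ∈ P, ∑ j, c j * x j ≤ δ) ∧
    F = {x ∈ P | ∑ j, c j * x j = δ}

/-- `y` is feasible for the dual LP `min {bᵀy : Aᵀy = w, y ≥ 0}`. -/
def DualFeasible {m n : ℕ} (A : Matrix (Fin m) (Fin n) ℤ) (w : Fin n → ℤ)
    (y : Fin m → ℝ) : Prop :=
  (∀ i, 0 ≤ y i) ∧ ∀ j, ∑ i, y i * (A i j : ℝ) = (w j : ℝ)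

/-- `y` is an optimal solution of the dual LP `min {bᵀy : Aᵀy = w, y ≥ 0}`. -/
def DualOptimal {m n : ℕ} (A : Matrix (Fin m) (Fin n) ℤ) (b : Fin m → ℤ) (w : Fin n → ℤ)
    (y : Fin m → ℝ) : Prop :=
  DualFeasible A w y ∧
    ∀ y', DualFeasible A w y' → ∑ i, (b i : ℝ) * y i ≤ ∑ i, (b i : ℝ) * y' i

/-- The system `Ax ≤ b` is totally dual `p`-adic. -/
def TotallyDualPadic (p : ℕ) {m n : ℕ} (A : Matrix (Fin m) (Fin n) ℤ) (b : Fin m → ℤ) : Prop :=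
  ∀ w : Fin n → ℤ, (∃ y, DualOptimal A b w y) →
    ∃ y, DualOptimal A b w y ∧ ∀ i, IsPadic p (y i)

theorem farkas_aux {V ι : Type} [AddCommGroup V] [Module ℝ V] (s : Finset ι) :
    ∀ (f : ι → V →ₗ[ℝ] ℝ) (g : V →ₗ[ℝ] ℝ),
      (∀ x, (∀ i ∈ s, f i x ≤ 0) → g x ≤ 0) →
      ∃ l : ι → ℝ, (∀ i, 0 ≤ l i) ∧ ∀ x, g x = ∑ i ∈ s, l i * f i x := by
  induction s using Finset.induction_on with
  | empty =>
    intro f g h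
    refine ⟨fun _ => 0, fun _ => le_rfl, fun x => ?_⟩
    have h1 := h x (by simp)
    have h2 := h (-x) (by simp)
    simp at h2 ⊢
    linarith
  | insert k s hk ih =>
    intro f g h
    by_cases hc : ∀ x, (∀ i ∈ s, f i x ≤ 0) → g x ≤ 0
    · obtain ⟨l, hl, hg⟩ := ih f g hc
      refine ⟨fun i => if i = k then 0 else l i, fun i => ?_, fun x => ?_⟩
      · dsimp only
        split_ifs
        · exact le_rfl
        · exact hl i
      · rw [Finset.sum_insert hk, hg x]
        simp only [if_true, zero_mul, zero_add]
        refine Finset.sum_congr rfl fun i hi => ?_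
        rw [if_neg (fun hik : i = k => hk (hik ▸ hi))]
    · push Not at hc
      obtain ⟨x0, hx0, hgx0⟩ := hc
      have hk0 : 0 < f k x0 := by
        by_contra hcon
        have := h x0 (by
          intro i hi
          rcases Finset.mem_insert.1 hi with rfl | hi
          · linarith
          · exact hx0 i hi)
        linarith
      set t := f k x0 with ht
      let T : V →ₗ[ℝ] V := LinearMap.id - (t⁻¹ • (f k)).smulRight x0
      have hT : ∀ x, T x = x - (t⁻¹ * f k x) • x0 := fun x => by simp [T]
      obtain ⟨l, hl, hg⟩ := ih (fun i => (f i).comp T) (g.comp T) (by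
        intro x hx
        refine h (T x) ?_
        intro i hi
        rcases Finset.mem_insert.1 hi with rfl | hi
        · rw [hT, map_sub, map_smul, smul_eq_mul, ← ht]
          apply le_of_eq
          field_simp
          ring
        · exact hx i hi)
      refine ⟨fun i => if i = k then t⁻¹ * (g x0 - ∑ i ∈ s, l i * f i x0) else l i,
        fun i => ?_, fun x => ?_⟩
      · dsimp only
        split_ifs
        · apply mul_nonneg (inv_nonneg.2 hk0.le)
          have : ∑ i ∈ s, l i * f i x0 ≤ 0 :=
            Finset.sum_nonpos fun i hi => mul_nonpos_of_nonneg_of_nonpos (hl i) (hx0 i hi)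
          linarith
        · exact hl i
      · rw [Finset.sum_insert hk]
        have e1 : ∑ i ∈ s, (if i = k then t⁻¹ * (g x0 - ∑ i ∈ s, l i * f i x0) else l i) * f i x
            = ∑ i ∈ s, l i * f i x := by
          refine Finset.sum_congr rfl fun i hi => ?_
          rw [if_neg (fun hik : i = k => hk (hik ▸ hi))]
        rw [e1]
        have := hg x
        simp only [LinearMap.comp_apply, hT, map_sub, map_smul, smul_eq_mul] at this
        simp only [mul_sub, Finset.sum_sub_distrib] at this
        have e2 : ∑ i ∈ s, l i * (t⁻¹ * f k x * f i x0)
            = t⁻¹ * f k x * ∑ i ∈ s, l i * f i x0 := by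
          rw [Finset.mul_sum]
          exact Finset.sum_congr rfl fun i _ => by ring
        rw [e2] at this
        simp only [if_true]
        linear_combination this

/-- homogenized functional -/
noncomputable def homog {V : Type} [AddCommGroup V] [Module ℝ V] (f : V →ₗ[ℝ] ℝ) (d : ℝ) :
    (V × ℝ) →ₗ[ℝ] ℝ := f.comp (LinearMap.fst ℝ V ℝ) + d • LinearMap.snd ℝ V ℝ

theorem homog_apply {V : Type} [AddCommGroup V] [Module ℝ V] (f : V →ₗ[ℝ] ℝ) (d : ℝ)
    (x : V × ℝ) : homog f d x = f x.1 + d * x.2 := by simp [homog]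

theorem farkas_homog {V κ : Type} [Fintype κ] [AddCommGroup V] [Module ℝ V]
    (a : κ → V →ₗ[ℝ] ℝ) (d : κ → ℝ) (c : V →ₗ[ℝ] ℝ) (e : ℝ)
    (h : ∀ x s, s ≤ 0 → (∀ k, a k x + d k * s ≤ 0) → c x + e * s ≤ 0) :
    ∃ u : κ → ℝ, (∀ k, 0 ≤ u k) ∧ (∀ x, c x = ∑ k, u k * a k x) ∧ ∑ k, u k * d k ≤ e := by
  obtain ⟨l, hl, hg⟩ := farkas_aux (Finset.univ : Finset (Option κ))
    (fun o => o.elim (homog (0 : V →ₗ[ℝ] ℝ) 1) fun k => homog (a k) (d k)) (homog c e) (by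
      intro x hx
      have h0 := hx none (Finset.mem_univ _)
      simp only [Option.elim, homog_apply] at h0
      rw [homog_apply]
      apply h
      · simpa using h0
      · intro k
        have := hx (some k) (Finset.mem_univ _)
        simpa only [Option.elim, homog_apply] using this)
  refine ⟨fun k => l (some k), fun k => hl _, fun x => ?_, ?_⟩
  · have := hg (x, 0)
    simpa [Fintype.sum_option, homog_apply] using this
  · have := hg (0, 1)
    simp [Fintype.sum_option, homog_apply] at this
    have := hl none
    linarith

theorem farkas_infeasible {V κ : Type} [Fintype κ] [AddCommGroup V] [Module ℝ V]
    (a : κ → V →ₗ[ℝ] ℝ) (d : κ → ℝ) (h : ¬ ∃ x, ∀ k, a k x ≤ d k) :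
    ∃ u : κ → ℝ, (∀ k, 0 ≤ u k) ∧ (∀ x, ∑ k, u k * a k x = 0) ∧ ∑ k, u k * d k < 0 := by
  obtain ⟨u, hu, h1, h2⟩ := farkas_homog a d 0 (-1) (by
    intro x s hs hx
    by_contra hcon
    have hs' : s < 0 := by
      simp at hcon
      linarith
    apply h
    refine ⟨(-s)⁻¹ • x, fun k => ?_⟩
    rw [map_smul, smul_eq_mul, inv_mul_le_iff₀ (by linarith)]
    have := hx k
    linarith)
  refine ⟨u, hu, fun x => ?_, by linarith⟩
  have := h1 x
  simpa using this.symm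

theorem farkas_affine {V κ : Type} [Fintype κ] [AddCommGroup V] [Module ℝ V]
    (a : κ → V →ₗ[ℝ] ℝ) (d : κ → ℝ) (c : V →ₗ[ℝ] ℝ) (e : ℝ)
    (hne : ∃ x, ∀ k, a k x ≤ d k) (h : ∀ x, (∀ k, a k x ≤ d k) → c x ≤ e) :
    ∃ u : κ → ℝ, (∀ k, 0 ≤ u k) ∧ (∀ x, c x = ∑ k, u k * a k x) ∧ ∑ k, u k * d k ≤ e := by
  apply farkas_homog
  intro x s hs hx
  rcases hs.lt_or_eq with hs' | rfl
  · have := h ((-s)⁻¹ • x) (fun k => by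
      rw [map_smul, smul_eq_mul, inv_mul_le_iff₀ (by linarith)]
      have := hx k
      linarith)
    rw [map_smul, smul_eq_mul, inv_mul_le_iff₀ (by linarith)] at this
    linarith
  · simp only [mul_zero, add_zero] at hx ⊢
    by_contra hcon
    push Not at hcon
    obtain ⟨x0, hx0⟩ := hne
    have := h (x0 + ((|e - c x0| + 1) / c x) • x) (fun k => by
      rw [map_add, map_smul, smul_eq_mul]
      have h1 := hx0 k
      have h2 : (|e - c x0| + 1) / c x * a k x ≤ 0 :=
        mul_nonpos_of_nonneg_of_nonpos (by positivity) (hx k)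
      linarith)
    rw [map_add, map_smul, smul_eq_mul, div_mul_cancel₀ _ hcon.ne'] at this
    have := le_abs_self (e - c x0)
    linarith

theorem IsPadic.add {p : ℕ} (hp : p.Prime) {r s : ℝ} (hr : IsPadic p r) (hs : IsPadic p s) :
    IsPadic p (r + s) := by
  obtain ⟨a, k, rfl⟩ := hr
  obtain ⟨c, l, rfl⟩ := hs
  have : (p : ℝ) ≠ 0 := by exact_mod_cast hp.ne_zero
  refine ⟨a * p ^ l + c * p ^ k, k + l, ?_⟩
  push_cast
  field_simp
  ring

theorem IsPadic.int (p : ℕ) (a : ℤ) : IsPadic p a := ⟨a, 0, by simp⟩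

theorem IsPadic.mul_int {p : ℕ} {r : ℝ} (hr : IsPadic p r) (c : ℤ) : IsPadic p (r * c) := by
  obtain ⟨a, k, rfl⟩ := hr
  exact ⟨a * c, k, by push_cast; ring⟩

theorem IsPadic.sum {p : ℕ} (hp : p.Prime) {ι : Type} (s : Finset ι) (f : ι → ℝ)
    (h : ∀ i, IsPadic p (f i)) : IsPadic p (∑ i ∈ s, f i) := by
  induction s using Finset.induction_on with
  | empty => simpa using IsPadic.int p 0
  | insert k s hk ih =>
    rw [Finset.sum_insert hk]
    exact (h k).add hp ih

theorem padic_approx {p : ℕ} (hp : p.Prime) (x : ℝ) :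
    Filter.Tendsto (fun K : ℕ => (⌊x * (p : ℝ) ^ K⌋ : ℝ) / (p : ℝ) ^ K) Filter.atTop (nhds x) := by
  have hp1 : (1 : ℝ) < p := by exact_mod_cast hp.one_lt
  have h0 : Filter.Tendsto (fun K : ℕ => x - ((p : ℝ) ^ K)⁻¹) Filter.atTop (nhds x) := by
    have := (tendsto_inv_atTop_zero.comp (tendsto_pow_atTop_atTop_of_one_lt hp1))
    simpa using this.const_sub x
  refine tendsto_of_tendsto_of_tendsto_of_le_of_le h0 tendsto_const_nhds (fun K => ?_) (fun K => ?_)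
  · have hpos : (0 : ℝ) < (p : ℝ) ^ K := by positivity
    dsimp only
    rw [le_div_iff₀ hpos, sub_mul, inv_mul_cancel₀ hpos.ne']
    exact (Int.sub_one_lt_floor _).le
  · have hpos : (0 : ℝ) < (p : ℝ) ^ K := by positivity
    dsimp only
    rw [div_le_iff₀ hpos]
    exact Int.floor_le _

theorem kernel_rational {ι d : Type} [Fintype ι] [Fintype d] (a : ι → d → ℤ) (v : ι → ℝ)
    (hv : ∀ j, ∑ i, v i * (a i j : ℝ) = 0) :
    ∃ (r : ℕ) (e : Fin r → ℝ) (q : Fin r → ι → ℤ),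
      (∀ i, v i = ∑ k, e k * (q k i : ℝ)) ∧ ∀ k j, ∑ i, q k i * a i j = 0 := by
  let S : Submodule ℚ ℝ := Submodule.span ℚ (Set.range v)
  have : FiniteDimensional ℚ S := FiniteDimensional.span_of_finite ℚ (Set.finite_range v)
  let B := Module.finBasis ℚ S
  let v' : ι → S := fun i => ⟨v i, Submodule.subset_span ⟨i, rfl⟩⟩
  have hv' : ∀ j, ∑ i, (a i j : ℚ) • v' i = 0 := by
    intro j
    apply Subtype.ext
    refine Eq.trans ?_ (hv j)
    simp only [AddSubmonoidClass.coe_finsetSum, SetLike.val_smul, v']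
    refine Finset.sum_congr rfl fun i _ => ?_
    rw [Rat.smul_def]
    push_cast
    ring
  let q : Fin (Module.finrank ℚ S) → ι → ℚ := fun k i => B.repr (v' i) k
  have hq : ∀ k j, ∑ i, q k i * (a i j : ℚ) = 0 := by
    intro k j
    have := congrArg (fun z => B.repr z k) (hv' j)
    simp only [map_sum, map_smul, map_zero, Finsupp.coe_finsetSum, Finset.sum_apply,
      Finsupp.smul_apply, smul_eq_mul, Finsupp.coe_zero, Pi.zero_apply] at this
    rw [← this]
    exact Finset.sum_congr rfl fun i _ => mul_comm _ _
  have hvq : ∀ i, v i = ∑ k, (B k : ℝ) * (q k i : ℝ) := by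
    intro i
    have := congrArg (Subtype.val) (B.sum_repr (v' i))
    simp only [AddSubmonoidClass.coe_finsetSum, SetLike.val_smul] at this
    rw [show v i = (v' i : ℝ) from rfl, ← this]
    refine Finset.sum_congr rfl fun k _ => ?_
    rw [Rat.smul_def, mul_comm]
  let N : ℕ := ∏ x : Fin (Module.finrank ℚ S) × ι, (q x.1 x.2).den
  have hN : (N : ℚ) ≠ 0 := by
    have : N ≠ 0 := Finset.prod_ne_zero_iff.2 fun x _ => (q x.1 x.2).den_nz
    exact_mod_cast this
  have hint : ∀ k i, ∃ z : ℤ, (z : ℚ) = N * q k i := by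
    intro k i
    obtain ⟨c, hc⟩ : (q k i).den ∣ N :=
      Finset.dvd_prod_of_mem (fun x : Fin (Module.finrank ℚ S) × ι => (q x.1 x.2).den)
        (Finset.mem_univ (k, i))
    refine ⟨c * (q k i).num, ?_⟩
    rw [hc]
    push_cast
    have := Rat.den_mul_eq_num (q k i)
    rw [← this]
    ring
  choose z hz using hint
  refine ⟨_, fun k => (B k : ℝ) / N, z, fun i => ?_, fun k j => ?_⟩
  · rw [hvq i]
    refine Finset.sum_congr rfl fun k _ => ?_
    have h1 : ((z k i : ℚ) : ℝ) = ((N * q k i : ℚ) : ℝ) := by rw [hz]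
    push_cast at h1
    rw [h1]
    have : (N : ℝ) ≠ 0 := by exact_mod_cast hN
    field_simp
  · have : ((∑ i, z k i * a i j : ℤ) : ℚ) = 0 := by
      push_cast
      simp only [hz, mul_assoc]
      rw [← Finset.mul_sum, hq, mul_zero]
    exact_mod_cast this

theorem positive_padic {p : ℕ} (hp : p.Prime) {ι d : Type} [Fintype ι] [Fintype d]
    (a : ι → d → ℤ) (w : d → ℤ) (y z : ι → ℝ) (hy : ∀ i, 0 < y i)
    (hyw : ∀ j, ∑ i, y i * (a i j : ℝ) = w j)
    (hz : ∀ i, IsPadic p (z i)) (hzw : ∀ j, ∑ i, z i * (a i j : ℝ) = w j) :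
    ∃ x : ι → ℝ, (∀ i, 0 ≤ x i) ∧ (∀ i, IsPadic p (x i)) ∧
      ∀ j, ∑ i, x i * (a i j : ℝ) = w j := by
  obtain ⟨r, e, q, h1, h2⟩ := kernel_rational a (fun i => y i - z i) (fun j => by
    simp only [sub_mul, Finset.sum_sub_distrib]
    rw [hyw, hzw, sub_self])
  let X : ℕ → ι → ℝ := fun K i => z i + ∑ k, (⌊e k * (p : ℝ) ^ K⌋ : ℝ) / (p : ℝ) ^ K * (q k i : ℝ)
  have hX : ∀ i, Filter.Tendsto (fun K => X K i) Filter.atTop (nhds (y i)) := by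
    intro i
    have : y i = z i + ∑ k, e k * (q k i : ℝ) := by rw [← h1 i]; ring
    rw [this]
    exact Filter.Tendsto.const_add _
      (tendsto_finsetSum _ fun k _ => (padic_approx hp (e k)).mul_const _)
  have hev : ∀ᶠ K in Filter.atTop, ∀ i, 0 < X K i :=
    Filter.eventually_all.2 fun i => (hX i).eventually_const_lt (hy i)
  obtain ⟨K, hK⟩ := hev.exists
  refine ⟨X K, fun i => (hK i).le, fun i => ?_, fun j => ?_⟩
  · exact (hz i).add hp (IsPadic.sum hp _ _ fun k => IsPadic.mul_int ⟨_, _, rfl⟩ _)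
  · simp only [X, add_mul, Finset.sum_add_distrib, hzw, Finset.sum_mul]
    rw [Finset.sum_comm]
    simp only [mul_assoc, ← Finset.mul_sum]
    have : ∀ k, ∑ i, (q k i : ℝ) * (a i j : ℝ) = 0 := fun k => by exact_mod_cast h2 k j
    simp [this]

theorem IsPGSC.isPGSS {p : ℕ} (hp : p.Prime) {ι d : Type} [Fintype ι] [Fintype d]
    {a : ι → d → ℤ} (h : IsPGSC p a) : IsPGSS p a := by
  rintro w ⟨l, hl⟩
  obtain ⟨N, hN⟩ := exists_nat_ge (∑ i, |l i|)
  obtain ⟨l', -, h2, h3⟩ := h (fun j => w j + N * ∑ i, a i j) ⟨fun i => l i + N, fun i => by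
      have h1 : |l i| ≤ ∑ i, |l i| :=
        Finset.single_le_sum (f := fun i => |l i|) (fun i _ => abs_nonneg _) (Finset.mem_univ i)
      have := neg_abs_le (l i)
      linarith, fun j => by
      simp only [add_mul, Finset.sum_add_distrib, hl, ← Finset.mul_sum]
      push_cast
      rfl⟩
  refine ⟨fun i => l' i + ((-N : ℤ) : ℝ), fun i => (h2 i).add hp (IsPadic.int p _), fun j => ?_⟩
  simp only [add_mul, Finset.sum_add_distrib, h3, ← Finset.mul_sum]
  push_cast
  ring

/-- The linear functional of a row. -/
noncomputable def rowL {n : ℕ} (v : Fin n → ℝ) : (Fin n → ℝ) →ₗ[ℝ] ℝ :=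
  ∑ j, v j • LinearMap.proj j

theorem rowL_apply {n : ℕ} (v x : Fin n → ℝ) : rowL v x = ∑ j, v j * x j := by
  simp [rowL]

theorem rowL_single {n : ℕ} (v : Fin n → ℝ) (j : Fin n) : rowL v (Pi.single j 1) = v j := by
  rw [rowL_apply]
  simp [Pi.single_apply]

theorem sum_subtype_zero {ι : Type} [Fintype ι] {q : ι → Prop} [Fintype {i // q i}]
    (g : ι → ℝ) (h : ∀ i, ¬ q i → g i = 0) : ∑ i : {i // q i}, g i.1 = ∑ i, g i := by
  rw [← Finset.sum_subtype (Finset.univ.filter q) (by simp) g]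
  refine Finset.sum_filter_of_ne fun i _ hi => ?_
  by_contra hq
  exact hi (h i hq)

theorem DualFeasible.dot {m n : ℕ} {A : Matrix (Fin m) (Fin n) ℤ} {w : Fin n → ℤ}
    {y : Fin m → ℝ} (h : DualFeasible A w y) (x : Fin n → ℝ) :
    ∑ j, (w j : ℝ) * x j = ∑ i, y i * ∑ j, (A i j : ℝ) * x j := by
  simp only [← h.2, Finset.sum_mul, Finset.mul_sum]
  rw [Finset.sum_comm]
  simp only [mul_assoc]

theorem DualFeasible.weak {m n : ℕ} {A : Matrix (Fin m) (Fin n) ℤ} {b : Fin m → ℤ} {w : Fin n → ℤ}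
    {y : Fin m → ℝ} (h : DualFeasible A w y) {x : Fin n → ℝ}
    (hx : ∀ i, ∑ j, (A i j : ℝ) * x j ≤ (b i : ℝ)) :
    ∑ j, (w j : ℝ) * x j ≤ ∑ i, (b i : ℝ) * y i := by
  rw [h.dot]
  refine Finset.sum_le_sum fun i _ => ?_
  rw [mul_comm (b i : ℝ)]
  exact mul_le_mul_of_nonneg_left (hx i) (h.1 i)

theorem DualFeasible.slack {m n : ℕ} {A : Matrix (Fin m) (Fin n) ℤ} {b : Fin m → ℤ}
    {w : Fin n → ℤ} {y : Fin m → ℝ} (h : DualFeasible A w y) {x : Fin n → ℝ}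
    (hx : ∀ i, ∑ j, (A i j : ℝ) * x j ≤ (b i : ℝ))
    (hle : ∑ i, (b i : ℝ) * y i ≤ ∑ j, (w j : ℝ) * x j) (i : Fin m) (hi : y i ≠ 0) :
    ∑ j, (A i j : ℝ) * x j = (b i : ℝ) := by
  rw [h.dot] at hle
  have hnn : ∀ i ∈ Finset.univ, 0 ≤ y i * ((b i : ℝ) - ∑ j, (A i j : ℝ) * x j) :=
    fun i _ => mul_nonneg (h.1 i) (sub_nonneg.2 (hx i))
  have h0 : ∑ i, y i * ((b i : ℝ) - ∑ j, (A i j : ℝ) * x j) = 0 := by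
    apply le_antisymm _ (Finset.sum_nonneg hnn)
    simp only [mul_sub, Finset.sum_sub_distrib]
    simp only [mul_comm (y _) (b _ : ℝ)]
    linarith
  have := (Finset.sum_eq_zero_iff_of_nonneg hnn).1 h0 i (Finset.mem_univ i)
  rcases mul_eq_zero.1 this with h1 | h1
  · exact absurd h1 hi
  · linarith

theorem tdp_to_pgsc {m n : ℕ} (p : ℕ) (A : Matrix (Fin m) (Fin n) ℤ) (b : Fin m → ℤ)
    (h : TotallyDualPadic p A b) (F : Set (Fin n → ℝ))
    (hF : IsFace {x | ∀ i, ∑ j, (A i j : ℝ) * x j ≤ (b i : ℝ)} F) (hne : F.Nonempty) :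
    IsPGSC p (fun i : {i : Fin m // ∀ x ∈ F, ∑ j, (A i j : ℝ) * x j = (b i : ℝ)} => A i.1) := by
  obtain ⟨c, δ, -, hFe⟩ := hF
  have hFP : ∀ x ∈ F, ∀ i, ∑ j, (A i j : ℝ) * x j ≤ (b i : ℝ) := by
    intro x hx
    rw [hFe] at hx
    exact hx.1
  rintro w ⟨l, hl0, hlw⟩
  let q : Fin m → Prop := fun i => ∀ x ∈ F, ∑ j, (A i j : ℝ) * x j = (b i : ℝ)
  let y : Fin m → ℝ := fun i => if hi : q i then l ⟨i, hi⟩ else 0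
  have hyl : ∀ i : {i // q i}, y i.1 = l i := fun i => by simp [y, i.2]
  have hyz : ∀ i, ¬ q i → y i = 0 := fun i hi => by simp [y, hi]
  have hyf : DualFeasible A w y := by
    refine ⟨fun i => ?_, fun j => ?_⟩
    · by_cases hi : q i
      · rw [hyl ⟨i, hi⟩]
        exact hl0 _
      · rw [hyz i hi]
    · rw [← hlw j, ← sum_subtype_zero (q := q) (fun i => y i * (A i j : ℝ))
        (fun i hi => by rw [hyz i hi, zero_mul])]
      exact Finset.sum_congr rfl fun i _ => by rw [hyl]
  have hval : ∀ x ∈ F, ∑ j, (w j : ℝ) * x j = ∑ i, (b i : ℝ) * y i := by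
    intro x hx
    rw [hyf.dot]
    refine Finset.sum_congr rfl fun i _ => ?_
    by_cases hi : q i
    · rw [hi x hx, mul_comm]
    · rw [hyz i hi, zero_mul, mul_zero]
  obtain ⟨x0, hx0⟩ := hne
  have hopt : DualOptimal A b w y := by
    refine ⟨hyf, fun y' hy' => ?_⟩
    rw [← hval x0 hx0]
    exact hy'.weak (hFP x0 hx0)
  obtain ⟨y', hy', hpad⟩ := h w ⟨y, hopt⟩
  have hz : ∀ i, ¬ q i → y' i = 0 := by
    intro i hi
    by_contra hcon
    apply hi
    intro x hx
    refine hy'.1.slack (hFP x hx) ?_ i hcon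
    rw [hval x hx]
    exact hy'.2 y hyf
  refine ⟨fun i => y' i.1, fun i => hy'.1.1 _, fun i => hpad _, fun j => ?_⟩
  rw [← hy'.1.2 j]
  exact sum_subtype_zero (q := q) (fun i => y' i * (A i j : ℝ))
    (fun i hi => by rw [hz i hi, zero_mul])

theorem pgss_to_tdp {m n : ℕ} (p : ℕ) (hp : p.Prime) (A : Matrix (Fin m) (Fin n) ℤ)
    (b : Fin m → ℤ)
    (h : ∀ F : Set (Fin n → ℝ),
        IsFace {x | ∀ i, ∑ j, (A i j : ℝ) * x j ≤ (b i : ℝ)} F → F.Nonempty →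
        IsPGSS p (fun i : {i : Fin m // ∀ x ∈ F, ∑ j, (A i j : ℝ) * x j = (b i : ℝ)} =>
          A i.1)) : TotallyDualPadic p A b := by
  rintro w ⟨y, hyf, hyo⟩
  let δ : ℝ := ∑ i, (b i : ℝ) * y i
  let M : Option (Fin m) → (Fin n → ℝ) →ₗ[ℝ] ℝ := fun o =>
    o.elim (-rowL fun j => (w j : ℝ)) fun i => rowL fun j => (A i j : ℝ)
  let D : Option (Fin m) → ℝ := fun o => o.elim (-δ) fun i => (b i : ℝ)
  have hMD : ∀ x, (∀ k, M k x ≤ D k) ↔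
      (∀ i, ∑ j, (A i j : ℝ) * x j ≤ (b i : ℝ)) ∧ δ ≤ ∑ j, (w j : ℝ) * x j := by
    intro x
    constructor
    · intro hk
      refine ⟨fun i => ?_, ?_⟩
      · have := hk (some i)
        simpa [M, D, rowL_apply] using this
      · have := hk none
        simpa [M, D, rowL_apply] using this
    · rintro ⟨h1, h2⟩ (_ | i)
      · simpa [M, D, rowL_apply] using h2
      · simpa [M, D, rowL_apply] using h1 i
  -- primal attainment
  have hfeas : ∃ x, ∀ k, M k x ≤ D k := by
    by_contra hcon
    obtain ⟨u, hu, hu1, hu2⟩ := farkas_infeasible M D hcon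
    have hU : ∀ j, ∑ i, u (some i) * (A i j : ℝ) = u none * w j := by
      intro j
      have := hu1 (Pi.single j 1)
      simp only [Fintype.sum_option, M, Option.elim, LinearMap.neg_apply, rowL_single] at this
      linarith
    have ht : 0 < 1 + u none := by
      have := hu none
      linarith
    have hf : DualFeasible A w (fun i => (y i + u (some i)) / (1 + u none)) := by
      refine ⟨fun i => div_nonneg (add_nonneg (hyf.1 i) (hu _)) ht.le, fun j => ?_⟩
      simp only [div_mul_eq_mul_div, ← Finset.sum_div, add_mul, Finset.sum_add_distrib, hyf.2, hU]
      field_simp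
    have := hyo _ hf
    simp only [mul_div_assoc', ← Finset.sum_div, mul_add, Finset.sum_add_distrib] at this
    rw [le_div_iff₀ ht] at this
    simp only [Fintype.sum_option, D, Option.elim, δ] at hu2
    simp only [mul_comm (b _ : ℝ) (u _)] at this
    linarith
  let F : Set (Fin n → ℝ) := {x | (∀ i, ∑ j, (A i j : ℝ) * x j ≤ (b i : ℝ)) ∧
    ∑ j, (w j : ℝ) * x j = δ}
  have hFm : ∀ x, (∀ k, M k x ≤ D k) ↔ x ∈ F := by
    intro x
    rw [hMD]
    constructor
    · rintro ⟨h1, h2⟩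
      exact ⟨h1, le_antisymm (hyf.weak h1) h2⟩
    · rintro ⟨h1, h2⟩
      exact ⟨h1, h2.ge⟩
  have hFface : IsFace {x | ∀ i, ∑ j, (A i j : ℝ) * x j ≤ (b i : ℝ)} F :=
    ⟨fun j => (w j : ℝ), δ, fun x hx => hyf.weak hx, rfl⟩
  have hFne : F.Nonempty := hfeas.imp fun x hx => (hFm x).1 hx
  let q : Fin m → Prop := fun i => ∀ x ∈ F, ∑ j, (A i j : ℝ) * x j = (b i : ℝ)
  -- any feasible solution of value at most δ is supported on q
  have hsupp : ∀ y', DualFeasible A w y' → ∑ i, (b i : ℝ) * y' i ≤ δ →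
      ∀ i, ¬ q i → y' i = 0 := by
    intro y' hy' hle i hi
    by_contra hcon
    apply hi
    intro x hx
    refine hy'.slack hx.1 ?_ i hcon
    rw [hx.2]
    exact hle
  -- strict complementarity
  have hstrict : ∀ i, ∃ y', DualFeasible A w y' ∧ ∑ i, (b i : ℝ) * y' i ≤ δ ∧
      (q i → 0 < y' i) := by
    intro i
    by_cases hi : q i
    swap
    · exact ⟨y, hyf, le_rfl, fun h => absurd h hi⟩
    obtain ⟨u, hu, hu1, hu2⟩ := farkas_affine M D (-rowL fun j => (A i j : ℝ)) (-(b i : ℝ)) hfeas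
      (by
        intro x hx
        have := hi x ((hFm x).1 hx)
        simp [rowL_apply, this])
    have hU : ∀ j, ∑ k, u (some k) * (A k j : ℝ) = u none * w j - A i j := by
      intro j
      have := hu1 (Pi.single j 1)
      simp only [Fintype.sum_option, M, Option.elim, LinearMap.neg_apply, rowL_single] at this
      linarith
    have ht : 0 < 1 + u none := by
      have := hu none
      linarith
    refine ⟨fun k => (y k + u (some k) + if k = i then 1 else 0) / (1 + u none), ⟨fun k => ?_,
      fun j => ?_⟩, ?_, fun _ => ?_⟩
    · refine div_nonneg (add_nonneg (add_nonneg (hyf.1 k) (hu _)) ?_) ht.le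
      split_ifs <;> norm_num
    · simp only [div_mul_eq_mul_div, ← Finset.sum_div, add_mul, Finset.sum_add_distrib, hyf.2, hU]
      simp only [ite_mul, one_mul, zero_mul, Finset.sum_ite_eq', Finset.mem_univ, if_true]
      field_simp
      ring
    · simp only [mul_div_assoc', ← Finset.sum_div, mul_add, Finset.sum_add_distrib]
      rw [div_le_iff₀ ht]
      simp only [Fintype.sum_option, D, Option.elim] at hu2
      simp only [mul_ite, mul_one, mul_zero, Finset.sum_ite_eq', Finset.mem_univ, if_true,
        mul_comm (b _ : ℝ) (u _)]
      have : ∑ i, (b i : ℝ) * y i = δ := rfl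
      rw [this]
      linarith
    · dsimp only
      rw [if_pos rfl]
      have := hyf.1 i
      have := hu (some i)
      exact div_pos (by linarith) ht
  choose Y hYf hYv hYp using hstrict
  have hm : (0 : ℝ) < m + 1 := by positivity
  let Z : Fin m → ℝ := fun i => (y i + ∑ k, Y k i) / (m + 1)
  have hZpos : ∀ i, q i → 0 < Z i := by
    intro i hi
    have h1 : Y i i ≤ ∑ k, Y k i :=
      Finset.single_le_sum (f := fun k => Y k i) (fun k _ => (hYf k).1 i) (Finset.mem_univ i)
    have h2 := hYp i hi
    have h3 := hyf.1 i
    exact div_pos (by linarith) hm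
  have hZ0 : ∀ i, ¬ q i → Z i = 0 := by
    intro i hi
    simp only [Z]
    rw [hsupp y hyf le_rfl i hi, Finset.sum_eq_zero fun k _ => hsupp (Y k) (hYf k) (hYv k) i hi]
    simp
  have hZw : ∀ j, ∑ i, Z i * (A i j : ℝ) = w j := by
    intro j
    simp only [Z, div_mul_eq_mul_div, ← Finset.sum_div, add_mul, Finset.sum_add_distrib, hyf.2,
      Finset.sum_mul]
    rw [Finset.sum_comm]
    simp only [(hYf _).2]
    simp
    field_simp
    ring
  have hZs : ∀ j, ∑ i : {i // q i}, Z i.1 * (A i.1 j : ℝ) = w j := by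
    intro j
    rw [← hZw j]
    exact sum_subtype_zero (q := q) (fun i => Z i * (A i j : ℝ))
      (fun i hi => by rw [hZ0 i hi, zero_mul])
  obtain ⟨z, hzp, hzw⟩ := h F hFface hFne w ⟨fun i => Z i.1, hZs⟩
  obtain ⟨x, hx0, hxp, hxw⟩ := positive_padic hp (fun i : {i // q i} => A i.1) w
    (fun i => Z i.1) z (fun i => hZpos i.1 i.2) hZs hzp hzw
  let X : Fin m → ℝ := fun i => if hi : q i then x ⟨i, hi⟩ else 0
  have hXx : ∀ i : {i // q i}, X i.1 = x i := fun i => by simp [X, i.2]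
  have hXz : ∀ i, ¬ q i → X i = 0 := fun i hi => by simp [X, hi]
  have hXf : DualFeasible A w X := by
    refine ⟨fun i => ?_, fun j => ?_⟩
    · by_cases hi : q i
      · rw [hXx ⟨i, hi⟩]
        exact hx0 _
      · rw [hXz i hi]
    · rw [← hxw j, ← sum_subtype_zero (q := q) (fun i => X i * (A i j : ℝ))
        (fun i hi => by rw [hXz i hi, zero_mul])]
      exact Finset.sum_congr rfl fun i _ => by rw [hXx]
  refine ⟨X, ⟨hXf, fun y' hy' => ?_⟩, fun i => ?_⟩
  · obtain ⟨x0, hx0F⟩ := hFne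
    have e : ∑ i, (b i : ℝ) * X i = ∑ j, (w j : ℝ) * x0 j := by
      rw [hXf.dot]
      refine Finset.sum_congr rfl fun i _ => ?_
      by_cases hi : q i
      · rw [hi x0 hx0F, mul_comm]
      · rw [hXz i hi, zero_mul, mul_zero]
    rw [e]
    exact hy'.weak hx0F.1
  · by_cases hi : q i
    · rw [hXx ⟨i, hi⟩]
      exact hxp _
    · rw [hXz i hi]
      simpa using IsPadic.int p 0

/-- For a prime `p`, the system `Ax ≤ b` is totally dual `p`-adic iff for
every nonempty face `F` of `P = {x : Ax ≤ b}` the rows of `A_F` (the implicit equalities of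
`F`) form a `p`-adic generating set for a cone, iff for every nonempty face `F` of `P` the
rows of `A_F` form a `p`-adic generating set for a subspace. -/
theorem totally_dual_padic_characterization {m n : ℕ} (p : ℕ) (hp : p.Prime)
    (A : Matrix (Fin m) (Fin n) ℤ) (b : Fin m → ℤ) :
    (TotallyDualPadic p A b ↔
      ∀ F : Set (Fin n → ℝ),
        IsFace {x | ∀ i, ∑ j, (A i j : ℝ) * x j ≤ (b i : ℝ)} F → F.Nonempty →
        IsPGSC p (fun i : {i : Fin m // ∀ x ∈ F, ∑ j, (A i j : ℝ) * x j = (b i : ℝ)} =>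
          A i.1)) ∧
    (TotallyDualPadic p A b ↔
      ∀ F : Set (Fin n → ℝ),
        IsFace {x | ∀ i, ∑ j, (A i j : ℝ) * x j ≤ (b i : ℝ)} F → F.Nonempty →
        IsPGSS p (fun i : {i : Fin m // ∀ x ∈ F, ∑ j, (A i j : ℝ) * x j = (b i : ℝ)} =>
          A i.1)) := by
  have h12 := tdp_to_pgsc p A b
  have h31 := pgss_to_tdp p hp A b
  exact ⟨⟨h12, fun h => h31 fun F hF hne => (h F hF hne).isPGSS hp⟩,
    ⟨fun h F hF hne => (h12 h F hF hne).isPGSS hp, h31⟩⟩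
end

section
/- Let p be a prime and A ∈ ℤ^{m×n} a matrix of rank r. Then the columns of A form a p-adic generating set for a subspace if, and only if, the greatest common divisor of the r×r subdeterminants of A is a power of p. -/
open Finset

attribute [local instance] Classical.propDecidable

theorem aux_dvd_row {r m : ℕ} (Y : Matrix (Fin r) (Fin m) ℤ) (A : Matrix (Fin m) (Fin r) ℤ)
    (d : ℤ) (h : ∀ f : Fin r → Fin m, Function.Injective f → d ∣ (A.submatrix f id).det) :
    d ∣ (Y * A).det := by
  have e : (Y * A).det = ∑ φ : Fin r → Fin m, (∏ i, Y i (φ i)) * (A.submatrix φ id).det := by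
    have h1 : (Y * A) = fun i => ∑ k, Y i k • A k := by
      ext i j
      simp [Matrix.mul_apply]
    have h2 : (Y * A).det = Matrix.detRowAlternating (Y * A) := rfl
    rw [h2, h1, ← AlternatingMap.coe_multilinearMap, MultilinearMap.map_sum]
    refine Finset.sum_congr rfl fun φ _ => ?_
    rw [MultilinearMap.map_smul_univ]
    rfl
  rw [e]
  refine Finset.dvd_sum fun φ _ => Dvd.dvd.mul_left ?_ _
  by_cases hφ : Function.Injective φ
  · exact h φ hφ
  · simp only [Function.Injective, not_forall] at hφ
    obtain ⟨a, b, hab, hne⟩ := hφ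
    rw [Matrix.det_zero_of_row_eq hne]
    · exact dvd_zero d
    · ext j; simp [hab]

theorem aux_dvd {r n m : ℕ} (Y : Matrix (Fin r) (Fin m) ℤ) (A : Matrix (Fin m) (Fin n) ℤ)
    (X : Matrix (Fin n) (Fin r) ℤ)
    (d : ℤ) (h : ∀ (f : Fin r → Fin m) (g : Fin r → Fin n),
      Function.Injective f → Function.Injective g → d ∣ (A.submatrix f g).det) :
    d ∣ (Y * A * X).det := by
  rw [Matrix.mul_assoc]
  refine aux_dvd_row _ _ _ fun f hf => ?_
  have e : (A * X).submatrix f id = (X.transpose * (A.submatrix f id).transpose).transpose := by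
    ext i j
    simp [Matrix.mul_apply, mul_comm]
  rw [e, Matrix.det_transpose]
  refine aux_dvd_row _ _ _ fun g hg => ?_
  rw [← Matrix.det_transpose]
  exact h f g hf hg

/-- Rows `f` generate all rows. -/
theorem aux_rows {m n r : ℕ} (A : Matrix (Fin m) (Fin n) ℚ) (hr : A.rank = r)
    (f : Fin r → Fin m) (g : Fin r → Fin n) (hd : (A.submatrix f g).det ≠ 0) :
    ∃ T : Matrix (Fin m) (Fin r) ℚ, A = T * A.submatrix f id := by
  have hli : LinearIndependent ℚ (fun k => A (f k)) := by
    have h1 : LinearIndependent ℚ (A.submatrix f g).row :=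
      Matrix.linearIndependent_rows_iff_isUnit.2
        ((Matrix.isUnit_iff_isUnit_det _).2 (isUnit_iff_ne_zero.2 hd))
    exact LinearIndependent.of_comp (LinearMap.funLeft ℚ ℚ g) h1
  have hle : Submodule.span ℚ (Set.range fun k => A (f k)) ≤ Submodule.span ℚ (Set.range A.row) :=
    Submodule.span_mono (by rintro _ ⟨k, rfl⟩; exact ⟨f k, rfl⟩)
  have heq := Submodule.eq_of_le_of_finrank_eq hle (by
    rw [← Matrix.rank_eq_finrank_span_row, hr, finrank_span_eq_card hli]; simp)
  have hmem : ∀ i, ∃ c : Fin r → ℚ, ∑ k, c k • A (f k) = A i := by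
    intro i
    have : A i ∈ Submodule.span ℚ (Set.range fun k => A (f k)) := by
      rw [heq]; exact Submodule.subset_span ⟨i, rfl⟩
    exact (Submodule.mem_span_range_iff_exists_fun ℚ).1 this
  choose T hT using hmem
  refine ⟨Matrix.of T, ?_⟩
  ext i j
  rw [← hT i]
  simp [Matrix.mul_apply]

theorem aux_cramer {m n r : ℕ} (A : Matrix (Fin m) (Fin n) ℤ)
    (hr : (A.map (Int.cast : ℤ → ℚ)).rank = r) (f : Fin r → Fin m) (g : Fin r → Fin n)
    (w : Fin m → ℤ) (lam : Fin n → ℝ) (hw : ∀ i, ∑ j, lam j * (A i j : ℝ) = (w i : ℝ)) :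
    ∃ y : Fin n → ℤ, A.mulVec y = (A.submatrix f g).det • w := by
  by_cases hd : (A.submatrix f g).det = 0
  · exact ⟨0, by simp [hd]⟩
  obtain ⟨T, hT⟩ := aux_rows (A.map (Int.cast : ℤ → ℚ)) hr f g (by
    have : (A.map (Int.cast : ℤ → ℚ)).submatrix f g
      = (A.submatrix f g).map (Int.cast : ℤ → ℚ) := rfl
    rw [this, ← Int.cast_det]
    exact_mod_cast hd)
  have hTe : ∀ i j, (A i j : ℚ) = ∑ k, T i k * (A (f k) j : ℚ) := by
    intro i j
    have := congrFun (congrFun hT i) j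
    simpa [Matrix.mul_apply] using this
  have hTr : ∀ i j, (A i j : ℝ) = ∑ k, (T i k : ℝ) * (A (f k) j : ℝ) := by
    intro i j
    exact_mod_cast congrArg (Rat.cast : ℚ → ℝ) (hTe i j)
  have hwT : ∀ i, (w i : ℝ) = ∑ k, (T i k : ℝ) * (w (f k) : ℝ) := by
    intro i
    rw [← hw i]
    simp_rw [← hw, hTr i, Finset.mul_sum]
    rw [Finset.sum_comm]
    refine Finset.sum_congr rfl fun k _ => Finset.sum_congr rfl fun j _ => by ring
  set B := A.submatrix f g with hB
  set x : Fin r → ℤ := B.adjugate.mulVec (fun k => w (f k)) with hx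
  have hBx : B.mulVec x = B.det • (fun k => w (f k)) := by
    rw [hx, Matrix.mulVec_mulVec, Matrix.mul_adjugate, Matrix.smul_mulVec, Matrix.one_mulVec]
  have hBx' : ∀ k, ∑ l, (A (f k) (g l) : ℝ) * (x l : ℝ) = (B.det : ℝ) * (w (f k) : ℝ) := by
    intro k
    have := congrFun hBx k
    simp only [Matrix.mulVec, dotProduct, hB, Matrix.submatrix_apply, Pi.smul_apply,
      smul_eq_mul] at this
    exact_mod_cast this
  refine ⟨∑ l, x l • Pi.single (g l) 1, ?_⟩
  ext i
  have e1 : A.mulVec (∑ l, x l • Pi.single (g l) 1) i = ∑ l, A i (g l) * x l := by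
    rw [Matrix.mulVec_sum, Finset.sum_apply]
    refine Finset.sum_congr rfl fun l _ => ?_
    rw [Matrix.mulVec_smul, Matrix.mulVec_single_one]
    simp [mul_comm]
  rw [e1]
  have : ((∑ l, A i (g l) * x l : ℤ) : ℝ) = ((B.det * w i : ℤ) : ℝ) := by
    rw [Int.cast_mul, Int.cast_sum]
    simp_rw [Int.cast_mul]
    rw [hwT i, Finset.mul_sum]
    simp_rw [hTr i, Finset.sum_mul]
    rw [Finset.sum_comm]
    refine Finset.sum_congr rfl fun k _ => ?_
    rw [mul_left_comm, ← hBx' k, Finset.mul_sum]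
    refine Finset.sum_congr rfl fun l _ => by ring
  exact_mod_cast this

/-- The lattice of integral vectors in the column space. -/
def auxL {m n : ℕ} (A : Matrix (Fin m) (Fin n) ℤ) : Submodule ℤ (Fin m → ℤ) where
  carrier := {w | ∃ lam : Fin n → ℝ, ∀ i, ∑ j, lam j * (A i j : ℝ) = (w i : ℝ)}
  zero_mem' := ⟨0, by simp⟩
  add_mem' := by
    rintro a b ⟨l, hl⟩ ⟨l', hl'⟩
    exact ⟨l + l', fun i => by simp [add_mul, Finset.sum_add_distrib, hl, hl']⟩
  smul_mem' := by
    rintro c a ⟨l, hl⟩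
    exact ⟨fun j => c * l j, fun i => by simp [mul_assoc, ← Finset.mul_sum, hl]⟩

theorem aux_split {m n : ℕ} (A : Matrix (Fin m) (Fin n) ℤ) :
    ∃ (s : ℕ) (B : Matrix (Fin m) (Fin s) ℤ) (Y : Matrix (Fin s) (Fin m) ℤ),
      Y * B = 1 ∧ B * (Y * A) = A ∧ ∀ l, (fun i => B i l) ∈ auxL A := by
  have htf : Module.IsTorsionFree ℤ ((Fin m → ℤ) ⧸ auxL A) := by
    rw [Module.isTorsionFree_iff_smul_eq_zero]
    intro c x hcx
    induction x using Submodule.Quotient.induction_on with | _ x => ?_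
    rw [← Submodule.Quotient.mk_smul, Submodule.Quotient.mk_eq_zero] at hcx
    rw [Submodule.Quotient.mk_eq_zero]
    by_cases hc : c = 0
    · exact Or.inl hc
    right
    obtain ⟨l, hl⟩ := hcx
    have hc' : (c : ℝ) ≠ 0 := by exact_mod_cast hc
    refine ⟨fun j => l j / c, fun i => ?_⟩
    have := hl i
    simp only [Pi.smul_apply, smul_eq_mul, Int.cast_mul] at this
    rw [eq_comm, ← mul_right_inj' hc', ← this, Finset.mul_sum]
    refine Finset.sum_congr rfl fun j _ => by field_simp
  have hfree : Module.Free ℤ ((Fin m → ℤ) ⧸ auxL A) := inferInstance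
  obtain ⟨σ, hσ⟩ := Module.projective_lifting_property (auxL A).mkQ LinearMap.id
    (Submodule.mkQ_surjective _)
  have hσ' : ∀ x, (auxL A).mkQ (σ x) = x := fun x => LinearMap.congr_fun hσ x
  set π : (Fin m → ℤ) →ₗ[ℤ] auxL A := LinearMap.codRestrict (auxL A)
    (LinearMap.id - σ ∘ₗ (auxL A).mkQ) (fun x => by
      rw [← Submodule.Quotient.mk_eq_zero, ← Submodule.mkQ_apply]
      simp only [LinearMap.sub_apply, LinearMap.comp_apply, map_sub, LinearMap.id_apply]
      rw [hσ', sub_self]) with hπ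
  have hπL : ∀ x : auxL A, π x = x := by
    intro x
    ext1
    have : (auxL A).mkQ (x : Fin m → ℤ) = 0 := by simp
    simp only [hπ, LinearMap.codRestrict_apply, LinearMap.sub_apply, LinearMap.comp_apply,
      this, map_zero, sub_zero, LinearMap.id_apply]
  let b := Module.finBasis ℤ (auxL A)
  let φ := b.equivFun.toLinearMap ∘ₗ π
  let ψ := (auxL A).subtype ∘ₗ b.equivFun.symm.toLinearMap
  have h1 : φ ∘ₗ ψ = LinearMap.id := by
    refine LinearMap.ext fun x => ?_
    simp only [φ, ψ, LinearMap.comp_apply, LinearEquiv.coe_coe, Submodule.subtype_apply, hπL,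
      LinearEquiv.apply_symm_apply, LinearMap.id_apply]
  have h2 : ∀ x ∈ auxL A, ψ (φ x) = x := by
    intro x hx
    have := hπL ⟨x, hx⟩
    simp only at this
    simp [φ, ψ, this]
  refine ⟨_, LinearMap.toMatrix' ψ, LinearMap.toMatrix' φ, ?_, ?_, ?_⟩
  · rw [← LinearMap.toMatrix'_comp, h1, LinearMap.toMatrix'_id]
  · rw [← Matrix.mul_assoc, ← LinearMap.toMatrix'_comp]
    have hcol : ∀ j, (fun i => A i j) ∈ auxL A := by
      intro j
      exact ⟨Pi.single j 1, fun i => by simp [Pi.single_apply]⟩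
    ext i j
    have h3 := congrFun (h2 _ (hcol j)) i
    have h4 := congrFun (LinearMap.toMatrix'_mulVec (ψ ∘ₗ φ) (fun i => A i j)) i
    rw [LinearMap.comp_apply, h3] at h4
    exact h4
  · intro l
    have : (fun i => LinearMap.toMatrix' ψ i l) = ψ (Pi.single l 1) := by
      ext i
      simp [LinearMap.toMatrix'_apply]
      try rfl
    rw [this]
    exact (b.equivFun.symm (Pi.single l 1)).2

theorem aux_pow {m n : ℕ} (p : ℕ) (hp : p.Prime) (A : Matrix (Fin m) (Fin n) ℤ)
    (h : IsPGSS p (fun j : Fin n => fun i : Fin m => A i j)) (w : Fin m → ℤ) (hw : w ∈ auxL A) :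
    ∃ K : ℕ, ∀ N, K ≤ N → ∃ y : Fin n → ℤ, A.mulVec y = ((p : ℤ) ^ N) • w := by
  obtain ⟨lam, hpad, hl⟩ := h w hw
  choose a k hk using hpad
  have hp0 : (p : ℝ) ≠ 0 := by exact_mod_cast hp.ne_zero
  refine ⟨∑ j, k j, fun N hN => ⟨fun j => a j * (p : ℤ) ^ (N - k j), ?_⟩⟩
  ext i
  have : ((∑ j, A i j * (a j * (p : ℤ) ^ (N - k j)) : ℤ) : ℝ) = (((p : ℤ) ^ N * w i : ℤ) : ℝ) := by
    push_cast
    rw [← hl i, Finset.mul_sum]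
    refine Finset.sum_congr rfl fun j _ => ?_
    have hkN : k j ≤ N := (Finset.single_le_sum (f := k) (by simp) (Finset.mem_univ j)).trans hN
    rw [hk j]
    obtain ⟨t, rfl⟩ := Nat.exists_eq_add_of_le hkN
    rw [Nat.add_sub_cancel_left, pow_add]
    field_simp
  simp only [Matrix.mulVec, dotProduct, Pi.smul_apply, smul_eq_mul]
  exact_mod_cast this

theorem aux_forward {m n : ℕ} (p : ℕ) (hp : p.Prime)
    (A : Matrix (Fin m) (Fin n) ℤ) (r : ℕ)
    (hr : (A.map (Int.cast : ℤ → ℚ)).rank = r)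
    (h : IsPGSS p (fun j : Fin n => fun i : Fin m => A i j)) :
    ∃ N : ℕ, ∀ d : ℤ,
          (∀ (f : Fin r → Fin m) (g : Fin r → Fin n),
            Function.Injective f → Function.Injective g → d ∣ (A.submatrix f g).det) →
          d ∣ (p : ℤ) ^ N := by
  obtain ⟨s, B, Y, hYB, hBYA, hB⟩ := aux_split A
  choose K hK using fun l => aux_pow p hp A h _ (hB l)
  choose y hy using fun l => hK l (∑ l, K l)
    (Finset.single_le_sum (f := K) (by simp) (Finset.mem_univ l))
  set M := ∑ l, K l
  have hAX : A * (Matrix.of y).transpose = ((p : ℤ) ^ M) • B := by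
    ext i l
    have := congrFun (hy l) i
    simpa [Matrix.mulVec, dotProduct, Matrix.mul_apply] using this
  have hYAX : Y * A * (Matrix.of y).transpose = ((p : ℤ) ^ M) • 1 := by
    rw [Matrix.mul_assoc, hAX, Matrix.mul_smul, hYB]
  have hsr : s = r := by
    rw [← hr]
    apply le_antisymm
    · have h1 : (Y.map (Int.cast : ℤ → ℚ)) * (A.map (Int.cast : ℤ → ℚ)) *
          ((Matrix.of y).transpose.map (Int.cast : ℤ → ℚ)) = ((p : ℚ) ^ M) • 1 := by
        ext i j
        have := congrFun (congrFun hYAX i) j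
        simp only [Matrix.mul_apply, Matrix.one_apply, Matrix.smul_apply, Matrix.map_apply,
          smul_eq_mul] at this ⊢
        exact_mod_cast congrArg (Int.cast : ℤ → ℚ) this
      have h2 : (((p : ℚ) ^ M) • (1 : Matrix (Fin s) (Fin s) ℚ)).rank = s := by
        rw [Matrix.rank_of_isUnit, Fintype.card_fin]
        rw [Matrix.isUnit_iff_isUnit_det, Matrix.det_smul, Matrix.det_one, isUnit_iff_ne_zero]
        have : (p : ℚ) ≠ 0 := by exact_mod_cast hp.ne_zero
        positivity
      calc s = _ := h2.symm
        _ = _ := by rw [← h1]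
        _ ≤ _ := Matrix.rank_mul_le_left _ _
        _ ≤ _ := Matrix.rank_mul_le_right _ _
    · have h1 : A.map (Int.cast : ℤ → ℚ) = (B.map (Int.cast : ℤ → ℚ)) *
          ((Y * A).map (Int.cast : ℤ → ℚ)) := by
        conv_lhs => rw [← hBYA]
        exact Matrix.map_mul (f := Int.castRingHom ℚ)
      rw [h1]
      refine (Matrix.rank_mul_le_left _ _).trans ?_
      simpa using Matrix.rank_le_width (B.map (Int.cast : ℤ → ℚ))
  subst hsr
  refine ⟨M * s, fun d hd => ?_⟩
  have := aux_dvd Y A (Matrix.of y).transpose d hd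
  rw [hYAX, Matrix.det_smul, Matrix.det_one] at this
  simpa [pow_mul] using this


/-- For a prime `p` and an integral `m × n` matrix `A` of rank `r`, the
columns of `A` form a `p`-adic generating set for a subspace iff the GCD of the `r × r`
subdeterminants of `A` is a power of `p` (expressed here by saying that some `p^k` is a
common divisor of all `r × r` subdeterminants which is divisible by every common divisor). -/
theorem pGSS_iff_gcd_power_of_p {m n : ℕ} (p : ℕ) (hp : p.Prime)
    (A : Matrix (Fin m) (Fin n) ℤ) (r : ℕ)
    (hr : (A.map (Int.cast : ℤ → ℚ)).rank = r) :
    IsPGSS p (fun j : Fin n => fun i : Fin m => A i j) ↔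
      ∃ k : ℕ,
        (∀ (f : Fin r → Fin m) (g : Fin r → Fin n),
          Function.Injective f → Function.Injective g →
          ((p : ℤ) ^ k ∣ (A.submatrix f g).det)) ∧
        (∀ d : ℤ,
          (∀ (f : Fin r → Fin m) (g : Fin r → Fin n),
            Function.Injective f → Function.Injective g → d ∣ (A.submatrix f g).det) →
          d ∣ (p : ℤ) ^ k) := by
  set P : ℤ → Prop := fun d => ∀ (f : Fin r → Fin m) (g : Fin r → Fin n),
            Function.Injective f → Function.Injective g → d ∣ (A.submatrix f g).det with hP
  set S : Set ℤ := {d | ∃ (f : Fin r → Fin m) (g : Fin r → Fin n),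
            Function.Injective f ∧ Function.Injective g ∧ d = (A.submatrix f g).det} with hS
  obtain ⟨G, hG⟩ := (IsPrincipalIdealRing.principal (Ideal.span S)).principal
  have hGP : P G := by
    intro f g hf hg
    have : (A.submatrix f g).det ∈ Ideal.span S := Ideal.subset_span ⟨f, g, hf, hg, rfl⟩
    rw [hG] at this
    exact Ideal.mem_span_singleton.1 this
  have hGmem : G ∈ Ideal.span S := by rw [hG]; exact Ideal.mem_span_singleton_self G
  have hGmax : ∀ d, P d → d ∣ G := by
    intro d hd
    rw [← Ideal.mem_span_singleton]
    refine (Ideal.span_le.2 ?_) hGmem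
    rintro _ ⟨f, g, hf, hg, rfl⟩
    exact Ideal.mem_span_singleton.2 (hd f g hf hg)
  constructor
  · intro h
    obtain ⟨N, hN⟩ := aux_forward p hp A r hr h
    obtain ⟨k, -, hk⟩ := (dvd_prime_pow (Nat.prime_iff_prime_int.1 hp) N).1 (hN G hGP)
    exact ⟨k, fun f g hf hg => hk.symm.dvd.trans (hGP f g hf hg),
      fun d hd => (hGmax d hd).trans hk.dvd⟩
  · rintro ⟨k, -, hk⟩ w ⟨lam, hlam⟩
    have hpk : (p : ℤ) ^ k ∈ Ideal.span S := by
      rw [hG]; exact Ideal.mem_span_singleton.2 (hk G hGP)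
    have hle : Ideal.span S ≤ Submodule.comap (LinearMap.toSpanSingleton ℤ (Fin m → ℤ) w)
        (LinearMap.range A.mulVecLin) := by
      refine Ideal.span_le.2 ?_
      rintro _ ⟨f, g, hf, hg, rfl⟩
      obtain ⟨y, hy⟩ := aux_cramer A hr f g w lam hlam
      exact ⟨y, by simpa using hy⟩
    obtain ⟨y, hy⟩ := hle hpk
    have hp0 : (p : ℝ) ≠ 0 := by exact_mod_cast hp.ne_zero
    refine ⟨fun j => (y j : ℝ) / (p : ℝ) ^ k, fun j => ⟨y j, k, rfl⟩, fun i => ?_⟩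
    have h1 := congrFun hy i
    simp [Matrix.mulVec, dotProduct] at h1
    have h2 : ∑ j, (A i j : ℝ) * (y j : ℝ) = (p : ℝ) ^ k * (w i : ℝ) := by exact_mod_cast h1
    have h3 : (w i : ℝ) = (∑ j, (A i j : ℝ) * (y j : ℝ)) / (p : ℝ) ^ k := by
      rw [h2]; field_simp
    rw [h3, Finset.sum_div]
    refine Finset.sum_congr rfl fun j _ => by ring
end

section
/- Let A ∈ ℤ^{m×n} and b ∈ ℤ^m. If the system Ax ≤ b is totally dual p-adic and totally dual q-adic for two distinct primes p and q, then the polyhedron {x : Ax ≤ b} is an integral polyhedron, i.e., every nonempty face of it contains an integral point. -/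
open Finset

attribute [local instance] Classical.propDecidable

lemma kronecker_aux {m n : ℕ} (B : Matrix (Fin m) (Fin n) ℤ) (β : Fin m → ℤ)
    (h : ∀ y : Fin m → ℚ, (∀ j, ∃ z : ℤ, ∑ i, y i * (B i j : ℚ) = z) →
      ∃ z : ℤ, ∑ i, y i * (β i : ℚ) = z) :
    ∃ x : Fin n → ℤ, B.mulVec x = β := by
  set M : Submodule ℤ (Fin m → ℤ) := LinearMap.range B.mulVecLin with hM
  by_contra hx
  have hβ : M.mkQ β ≠ 0 := by
    intro h0
    apply hx
    have : β ∈ M := by simpa using h0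
    obtain ⟨x, hx⟩ := this
    exact ⟨x, by simpa using hx⟩
  obtain ⟨χ, hχ⟩ := CharacterModule.exists_character_apply_ne_zero_of_ne_zero hβ
  have hrep : ∀ i : Fin m, ∃ y : ℚ, (y : AddCircle (1 : ℚ)) = χ (M.mkQ (Pi.single i 1)) := by
    intro i
    exact QuotientAddGroup.mk_surjective _
  choose y hy using hrep
  have key : ∀ v : Fin m → ℤ, χ (M.mkQ v) = ((∑ i, y i * (v i : ℚ) : ℚ) : AddCircle (1 : ℚ)) := by
    intro v
    have hv : v = ∑ i, v i • (Pi.single i 1 : Fin m → ℤ) := by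
      ext k
      simp [Finset.sum_apply, Pi.single_apply]
    have hs : ((∑ i, y i * (v i : ℚ) : ℚ) : AddCircle (1 : ℚ))
        = ∑ i, v i • ((y i : ℚ) : AddCircle (1 : ℚ)) := by
      have : ∀ s : Finset (Fin m), ((∑ i ∈ s, y i * (v i : ℚ) : ℚ) : AddCircle (1 : ℚ))
        = ∑ i ∈ s, v i • ((y i : ℚ) : AddCircle (1 : ℚ)) := by
        intro s
        induction s using Finset.induction_on with
        | empty => simp
        | insert a s ha ih =>
          rw [Finset.sum_insert ha, Finset.sum_insert ha, AddCircle.coe_add, ih,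
            ← AddCircle.coe_zsmul, zsmul_eq_mul, mul_comm (y a)]
      exact this _
    rw [hs]
    conv_lhs => rw [hv]
    rw [map_sum, map_sum]
    refine Finset.sum_congr rfl fun i _ => ?_
    rw [map_zsmul, map_zsmul, hy]
  have hcirc : ∀ r : ℚ, (r : AddCircle (1 : ℚ)) = 0 ↔ ∃ z : ℤ, r = z := by
    intro r
    rw [AddCircle.coe_eq_zero_iff]
    constructor
    · rintro ⟨z, hz⟩
      exact ⟨z, by simpa using hz.symm⟩
    · rintro ⟨z, hz⟩
      exact ⟨z, by simpa using hz.symm⟩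
  apply hχ
  rw [key, hcirc]
  apply h
  intro j
  rw [← hcirc, ← key (fun i => B i j)]
  have : M.mkQ (fun i => B i j) = 0 := by
    have : (fun i => B i j) ∈ M := ⟨Pi.single j 1, by ext i; simp⟩
    simpa using this
  rw [this, map_zero]

lemma isPadic_sum {p : ℕ} (hp : p.Prime) {m : ℕ} (b : Fin m → ℤ) (y : Fin m → ℝ)
    (hy : ∀ i, IsPadic p (y i)) : IsPadic p (∑ i, (b i : ℝ) * y i) := by
  have hp0 : (p : ℝ) ≠ 0 := by exact_mod_cast hp.ne_zero
  have : ∀ s : Finset (Fin m), IsPadic p (∑ i ∈ s, (b i : ℝ) * y i) := by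
    intro s
    induction s using Finset.induction_on with
    | empty => exact ⟨0, 0, by simp⟩
    | insert i s hi ih =>
      obtain ⟨a, k, h1⟩ := ih
      obtain ⟨a', k', h2⟩ := hy i
      rw [Finset.sum_insert hi, h1, h2]
      refine ⟨b i * a' * p ^ k + a * p ^ k', k' + k, ?_⟩
      push_cast
      rw [pow_add]
      field_simp
  exact this _

lemma int_of_padic {p q : ℕ} (hp : p.Prime) (hq : q.Prime) (hpq : p ≠ q) {r : ℝ}
    (h1 : IsPadic p r) (h2 : IsPadic q r) : ∃ z : ℤ, r = z := by
  obtain ⟨a, k, h1⟩ := h1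
  obtain ⟨c, l, h2⟩ := h2
  have hp0 : (p : ℝ) ≠ 0 := by exact_mod_cast hp.ne_zero
  have hq0 : (q : ℝ) ≠ 0 := by exact_mod_cast hq.ne_zero
  have h : a * (q : ℤ) ^ l = c * (p : ℤ) ^ k := by
    have : (a : ℝ) * (q : ℝ) ^ l = c * (p : ℝ) ^ k := by
      rw [h1] at h2
      field_simp at h2
      linarith
    exact_mod_cast this
  have hcop : IsCoprime ((p : ℤ) ^ k) ((q : ℤ) ^ l) :=
    (Nat.isCoprime_iff_coprime.2 ((Nat.coprime_primes hp hq).2 hpq)).pow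
  have hd : (p : ℤ) ^ k ∣ a := hcop.dvd_of_dvd_mul_right ⟨c, by rw [h, mul_comm]⟩
  obtain ⟨z, hz⟩ := hd
  refine ⟨z, ?_⟩
  rw [h1, hz]
  push_cast
  field_simp

lemma dot_line {n : ℕ} (c x d : Fin n → ℝ) (t : ℝ) :
    ∑ j, c j * (x j + t * d j) = ∑ j, c j * x j + t * ∑ j, c j * d j := by
  rw [Finset.mul_sum, ← Finset.sum_add_distrib]
  exact Finset.sum_congr rfl fun j _ => by ring

lemma dual_value {m n : ℕ} {A : Matrix (Fin m) (Fin n) ℤ} {w : Fin n → ℤ} {y : Fin m → ℝ}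
    (h : DualFeasible A w y) (x : Fin n → ℝ) :
    ∑ i, y i * (∑ j, (A i j : ℝ) * x j) = ∑ j, (w j : ℝ) * x j := by
  simp_rw [← h.2, Finset.mul_sum, Finset.sum_mul]
  rw [Finset.sum_comm]
  exact Finset.sum_congr rfl fun j _ => Finset.sum_congr rfl fun i _ => by ring

/-- Existence of a point of the face whose tight affine subspace lies in the face. -/
lemma min_face {m n : ℕ} (A : Matrix (Fin m) (Fin n) ℝ) (b : Fin m → ℝ) (c : Fin n → ℝ) (δ : ℝ)
    (hc : ∀ x : Fin n → ℝ, (∀ i, ∑ j, A i j * x j ≤ b i) → ∑ j, c j * x j ≤ δ)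
    (x₀ : Fin n → ℝ) (hx₀ : ∀ i, ∑ j, A i j * x₀ j ≤ b i) (hx₀' : ∑ j, c j * x₀ j = δ) :
    ∃ x : Fin n → ℝ, (∀ i, ∑ j, A i j * x j ≤ b i) ∧
      ∀ z : Fin n → ℝ, (∀ i, ∑ j, A i j * x j = b i → ∑ j, A i j * z j = b i) →
        (∀ i, ∑ j, A i j * z j ≤ b i) ∧ ∑ j, c j * z j = δ := by
  classical
  let T : (Fin n → ℝ) → Finset (Fin m) := fun x => Finset.univ.filter
    fun i => ∑ j, A i j * x j = b i
  let S : Set (Finset (Fin m)) := {s | ∃ x : Fin n → ℝ, (∀ i, ∑ j, A i j * x j ≤ b i) ∧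
    ∑ j, c j * x j = δ ∧ T x = s}
  obtain ⟨s, ⟨⟨x, hx, hxc, rfl⟩, hmax⟩⟩ := (Set.toFinite S).exists_maximal ⟨_, x₀, hx₀, hx₀', rfl⟩
  have hstep : ∀ d : Fin n → ℝ, (∀ i, ∑ j, A i j * x j = b i → ∑ j, A i j * d j = 0) →
      ∑ j, c j * d j ≤ 0 := by
    intro d hd
    have hev : ∀ᶠ ε in nhdsWithin (0 : ℝ) (Set.Ioi 0), ∀ i,
        ∑ j, A i j * x j + ε * ∑ j, A i j * d j ≤ b i := by
      rw [Filter.eventually_all]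
      intro i
      by_cases hi : ∑ j, A i j * x j = b i
      · exact Filter.Eventually.of_forall fun ε => by rw [hd i hi, hi]; simp
      · have hlt := lt_of_le_of_ne (hx i) hi
        have hcont : Continuous fun ε : ℝ => ∑ j, A i j * x j + ε * ∑ j, A i j * d j := by
          fun_prop
        have h0 : ∀ᶠ ε in nhds (0 : ℝ), ∑ j, A i j * x j + ε * ∑ j, A i j * d j < b i :=
          hcont.continuousAt.eventually_lt continuousAt_const (by simpa using hlt)
        exact (h0.filter_mono nhdsWithin_le_nhds).mono fun ε h => h.le
    obtain ⟨ε, h1, h2⟩ := (hev.and self_mem_nhdsWithin).exists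
    have h2 : 0 < ε := h2
    have := hc (fun j => x j + ε * d j) (fun i => by rw [dot_line]; exact h1 i)
    rw [dot_line, hxc] at this
    by_contra hcon
    push Not at hcon
    nlinarith [mul_pos h2 hcon]
  have hzero : ∀ d : Fin n → ℝ, (∀ i, ∑ j, A i j * x j = b i → ∑ j, A i j * d j = 0) →
      ∑ j, c j * d j = 0 := by
    intro d hd
    refine le_antisymm (hstep d hd) ?_
    have := hstep (fun j => - d j) (fun i hi => by simpa using hd i hi)
    simpa using this
  refine ⟨x, hx, fun z hz => ?_⟩
  set d : Fin n → ℝ := fun j => z j - x j with hd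
  have hzd : ∀ a : Fin n → ℝ, ∑ j, a j * z j = ∑ j, a j * x j + ∑ j, a j * d j := by
    intro a
    rw [← Finset.sum_add_distrib]
    exact Finset.sum_congr rfl fun j _ => by simp only [hd]; ring
  have hd0 : ∀ i, ∑ j, A i j * x j = b i → ∑ j, A i j * d j = 0 := by
    intro i hi
    have := hzd (A i)
    rw [hz i hi, hi] at this
    linarith
  refine ⟨?_, by rw [hzd, hxc, hzero d hd0, add_zero]⟩
  by_contra hcon
  push Not at hcon
  obtain ⟨k, hk⟩ := hcon
  let U : Finset (Fin m) := Finset.univ.filter fun i => 0 < ∑ j, A i j * d j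
  have hU : U.Nonempty := ⟨k, by
    simp only [U, Finset.mem_filter, Finset.mem_univ, true_and]
    have := hzd (A k)
    have := hx k
    linarith⟩
  obtain ⟨e, heU, he⟩ := U.exists_min_image
    (fun i => (b i - ∑ j, A i j * x j) / ∑ j, A i j * d j) hU
  have hepos : 0 < ∑ j, A e j * d j := by simpa [U] using heU
  set t := (b e - ∑ j, A e j * x j) / ∑ j, A e j * d j with ht
  have ht0 : 0 ≤ t := div_nonneg (by linarith [hx e]) hepos.le
  have hte : t * ∑ j, A e j * d j = b e - ∑ j, A e j * x j := by
    rw [ht]; field_simp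
  have hne : ∑ j, A e j * x j ≠ b e := fun h => by
    have := hd0 e h
    linarith
  have hsub : T x ≤ T (fun j => x j + t * d j) := by
    intro i hi
    have hi : ∑ j, A i j * x j = b i := by simpa [T] using hi
    simp only [T, Finset.mem_filter, Finset.mem_univ, true_and]
    rw [dot_line, hi, hd0 i hi]
    simp
  have hmem : T (fun j => x j + t * d j) ∈ S := by
    refine ⟨_, fun i => ?_, ?_, rfl⟩
    · rw [dot_line]
      by_cases hi : 0 < ∑ j, A i j * d j
      · have h1 := he i (by simpa [U] using hi)
        rw [le_div_iff₀ hi] at h1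
        linarith
      · have := hx i
        nlinarith
    · rw [dot_line, hxc, hzero d hd0]
      simp
  have h3 := hmax hmem hsub
  have h4 : e ∈ T (fun j => x j + t * d j) := by
    simp only [T, Finset.mem_filter, Finset.mem_univ, true_and]
    rw [dot_line, hte]
    ring
  have h5 := h3 h4
  simp only [T, Finset.mem_filter, Finset.mem_univ, true_and] at h5
  exact hne h5

/-- If `Ax ≤ b` is totally dual `p`-adic and totally dual `q`-adic for two
distinct primes `p, q`, then `{x : Ax ≤ b}` is an integral polyhedron: every nonempty face
contains an integral point. -/
theorem totally_dual_p_and_q_adic_implies_integral {m n : ℕ} (p q : ℕ)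
    (hp : p.Prime) (hq : q.Prime) (hpq : p ≠ q)
    (A : Matrix (Fin m) (Fin n) ℤ) (b : Fin m → ℤ)
    (hP : TotallyDualPadic p A b) (hQ : TotallyDualPadic q A b) :
    ∀ F : Set (Fin n → ℝ),
      IsFace {x | ∀ i, ∑ j, (A i j : ℝ) * x j ≤ (b i : ℝ)} F → F.Nonempty →
      ∃ x ∈ F, ∀ j, ∃ c : ℤ, x j = (c : ℝ) := by
  rintro F ⟨c, δ, hc, rfl⟩ ⟨x₀, hx₀, hx₀'⟩
  obtain ⟨x, hx, hmin⟩ := min_face (fun i j => (A i j : ℝ)) (fun i => (b i : ℝ)) c δ hc x₀ hx₀ hx₀'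
  let I : Fin m → Prop := fun i => ∑ j, (A i j : ℝ) * x j = (b i : ℝ)
  obtain ⟨z, hz⟩ := kronecker_aux (fun i j => if I i then A i j else 0)
    (fun i => if I i then b i else 0) (by
      intro y hy
      choose w hw using hy
      let N : ℤ := ∑ i, ⌈|y i|⌉
      have hN : ∀ i, 0 ≤ y i + N := by
        intro i
        have h1 : ⌈|y i|⌉ ≤ N := Finset.single_le_sum (f := fun i => ⌈|y i|⌉)
          (fun i _ => Int.ceil_nonneg (abs_nonneg _)) (Finset.mem_univ i)
        have h2 : |y i| ≤ (N : ℚ) := (Int.le_ceil _).trans (by exact_mod_cast h1)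
        linarith [neg_abs_le (y i)]
      let y' : Fin m → ℝ := fun i => if I i then ((y i + N : ℚ) : ℝ) else 0
      let w' : Fin n → ℤ := fun j => w j + ∑ i, N * (if I i then A i j else 0)
      have hfeas : DualFeasible A w' y' := by
        refine ⟨fun i => ?_, fun j => ?_⟩
        · simp only [y']
          split_ifs
          · exact_mod_cast hN i
          · exact le_rfl
        · have h1 : ((∑ i, y i * ((if I i then A i j else 0 : ℤ) : ℚ) : ℚ) : ℝ) = ((w j : ℚ) : ℝ) :=
            congrArg _ (hw j)
          simp only [w', y']
          push_cast at h1 ⊢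
          rw [← h1, ← Finset.sum_add_distrib]
          refine Finset.sum_congr rfl fun i _ => ?_
          split_ifs <;> push_cast <;> ring
      have hval : ∑ i, (b i : ℝ) * y' i = ∑ j, (w' j : ℝ) * x j := by
        rw [← dual_value hfeas]
        refine Finset.sum_congr rfl fun i _ => ?_
        by_cases hi : I i
        · rw [show ∑ j, (A i j : ℝ) * x j = (b i : ℝ) from hi, mul_comm]
        · simp [y', hi]
      have hopt : DualOptimal A b w' y' := by
        refine ⟨hfeas, fun y2 h2 => ?_⟩
        rw [hval, ← dual_value h2]
        refine Finset.sum_le_sum fun i _ => ?_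
        rw [mul_comm]
        exact mul_le_mul_of_nonneg_right (hx i) (h2.1 i)
      have hpad : ∀ r : ℕ, r.Prime → TotallyDualPadic r A b →
          IsPadic r (∑ i, (b i : ℝ) * y' i) := by
        intro r hr hT
        obtain ⟨u, hu, hup⟩ := hT w' ⟨y', hopt⟩
        rw [le_antisymm (hopt.2 u hu.1) (hu.2 y' hfeas)]
        exact isPadic_sum hr b u hup
      obtain ⟨k, hk⟩ := int_of_padic hp hq hpq (hpad p hp hP) (hpad q hq hQ)
      refine ⟨k - ∑ i, N * (if I i then b i else 0), ?_⟩
      have : ((∑ i, y i * ((if I i then b i else 0 : ℤ) : ℚ) : ℚ) : ℝ)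
          = (((k - ∑ i, N * (if I i then b i else 0) : ℤ) : ℚ) : ℝ) := by
        push_cast
        rw [← hk, ← Finset.sum_sub_distrib]
        refine Finset.sum_congr rfl fun i _ => ?_
        simp only [y']
        split_ifs <;> push_cast <;> ring
      exact_mod_cast this)
  refine ⟨fun j => (z j : ℝ), ?_, fun j => ⟨z j, rfl⟩⟩
  exact hmin _ (fun i hi => by
    have hi : I i := hi
    have h1 := congrFun hz i
    simp only [Matrix.mulVec, dotProduct, hi, if_true] at h1
    exact_mod_cast h1)
end

section
/- Let p be a prime, A ∈ ℤ^{m×n} a matrix every subdeterminant of which belongs to {0} ∪ {±p^k : k a nonnegative integer}, and b ∈ ℤ^m. Then the system Ax ≤ b is totally dual p-adic. -/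
open Finset

attribute [local instance] Classical.propDecidable

/-- A matrix with linearly independent rows has a nonsingular maximal square submatrix. -/
theorem exists_cols_det_ne_zero {r n : ℕ} (B : Matrix (Fin r) (Fin n) ℝ)
    (h : LinearIndependent ℝ B.row) :
    ∃ g : Fin r → Fin n, Function.Injective g ∧ (B.submatrix id g).det ≠ 0 := by
  have hr : Module.finrank ℝ (Submodule.span ℝ (Set.range B.col)) = r := by
    rw [← Matrix.rank_eq_finrank_span_cols, h.rank_matrix, Fintype.card_fin]
  obtain ⟨f, hf, -, hli⟩ :=
    Submodule.exists_fun_fin_finrank_span_eq ℝ (Set.range B.col)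
  generalize Module.finrank ℝ (Submodule.span ℝ (Set.range B.col)) = q at *
  subst hr
  choose g hg using hf
  have hfg : f = fun i => B.col (g i) := funext fun i => (hg i).symm
  refine ⟨g, ?_, ?_⟩
  · intro a c hac
    apply hli.injective
    rw [← hg a, ← hg c, hac]
  · have : LinearIndependent ℝ (B.submatrix id g).col := by
      rw [hfg] at hli
      exact hli
    rw [Matrix.linearIndependent_cols_iff_isUnit, Matrix.isUnit_iff_isUnit_det] at this
    exact this.ne_zero

/-- One pivoting step: move along `-z` until a coordinate vanishes. -/
theorem exists_pivot {m : ℕ} (y z : Fin m → ℝ) (hy : ∀ i, 0 ≤ y i)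
    (hz : ∀ i, y i = 0 → z i = 0) (hpos : ∃ i, 0 < z i) :
    ∃ ε : ℝ, 0 < ε ∧ (∀ i, 0 ≤ y i - ε * z i) ∧
      (univ.filter fun i => y i - ε * z i ≠ 0).card < (univ.filter fun i => y i ≠ 0).card := by
  obtain ⟨i1, hi1⟩ := hpos
  obtain ⟨i0, hi0, hmin⟩ := Finset.exists_min_image (univ.filter fun i => 0 < z i)
    (fun i => y i / z i) ⟨i1, by simpa using hi1⟩
  simp only [mem_filter, mem_univ, true_and] at hi0 hmin
  have hy0 : 0 < y i0 := lt_of_le_of_ne (hy i0) (fun h => by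
    have := hz i0 h.symm
    linarith)
  have hε : 0 < y i0 / z i0 := div_pos hy0 hi0
  have hzero : y i0 - y i0 / z i0 * z i0 = 0 := by
    field_simp
    ring
  refine ⟨y i0 / z i0, hε, ?_, ?_⟩
  · intro i
    by_cases h : 0 < z i
    · have := hmin i h
      rw [le_div_iff₀ h] at this
      linarith
    · have := mul_nonpos_of_nonneg_of_nonpos hε.le (not_lt.mp h)
      have := hy i
      linarith
  · apply Finset.card_lt_card
    rw [Finset.ssubset_iff_of_subset]
    · refine ⟨i0, by simpa using hy0.ne', ?_⟩
      simp only [mem_filter, mem_univ, true_and, not_not]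
      exact hzero
    · intro i
      simp only [mem_filter, mem_univ, true_and]
      intro h h'
      exact h (by rw [hz i h', h']; ring)

theorem dual_feasible_sub {m n : ℕ} {A : Matrix (Fin m) (Fin n) ℤ} {w : Fin n → ℤ}
    {y z : Fin m → ℝ} (hy : DualFeasible A w y) (hz : ∀ j, ∑ i, z i * (A i j : ℝ) = 0)
    (ε : ℝ) (h : ∀ i, 0 ≤ y i - ε * z i) : DualFeasible A w (fun i => y i - ε * z i) := by
  refine ⟨h, fun j => ?_⟩
  have : ∑ i, (y i - ε * z i) * (A i j : ℝ)
      = ∑ i, y i * (A i j : ℝ) - ε * ∑ i, z i * (A i j : ℝ) := by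
    rw [Finset.mul_sum, ← Finset.sum_sub_distrib]
    exact Finset.sum_congr rfl fun i _ => by ring
  rw [this, hz, hy.2]
  ring

theorem cost_sub {m : ℕ} (b : Fin m → ℤ) (y z : Fin m → ℝ) (ε : ℝ) :
    ∑ i, (b i : ℝ) * (y i - ε * z i)
      = ∑ i, (b i : ℝ) * y i - ε * ∑ i, (b i : ℝ) * z i := by
  rw [Finset.mul_sum, ← Finset.sum_sub_distrib]
  exact Finset.sum_congr rfl fun i _ => by ring

/-- An optimal solution of minimal support has linearly independent support rows. -/
theorem min_support {m n : ℕ} {A : Matrix (Fin m) (Fin n) ℤ} {b : Fin m → ℤ} {w : Fin n → ℤ}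
    {y : Fin m → ℝ} (hy : DualOptimal A b w y)
    (hmin : ∀ y', DualOptimal A b w y' →
      (univ.filter fun i => y i ≠ 0).card ≤ (univ.filter fun i => y' i ≠ 0).card)
    (z : Fin m → ℝ) (hz : ∀ i, y i = 0 → z i = 0)
    (hAz : ∀ j, ∑ i, z i * (A i j : ℝ) = 0) : z = 0 := by
  -- no such direction with nonnegative cost has a positive entry
  have key : ∀ z : Fin m → ℝ, (∀ i, y i = 0 → z i = 0) →
      (∀ j, ∑ i, z i * (A i j : ℝ) = 0) → 0 ≤ ∑ i, (b i : ℝ) * z i → ∀ i, z i ≤ 0 := by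
    intro z hz hAz hb
    by_contra! hne
    obtain ⟨ε, hε, hnn, hcard⟩ := exists_pivot y z hy.1.1 hz hne
    have hopt : DualOptimal A b w (fun i => y i - ε * z i) := by
      refine ⟨dual_feasible_sub hy.1 hAz ε hnn, fun y' hy' => ?_⟩
      have h1 := hy.2 y' hy'
      have h2 := cost_sub b y z ε
      have h3 := mul_nonneg hε.le hb
      linarith
    exact absurd (hmin _ hopt) (not_le.mpr hcard)
  have key2 : ∀ z : Fin m → ℝ, (∀ i, y i = 0 → z i = 0) →
      (∀ j, ∑ i, z i * (A i j : ℝ) = 0) → 0 ≤ ∑ i, (b i : ℝ) * z i → z = 0 := by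
    intro z hz hAz hb
    have hnp := key z hz hAz hb
    have hnn : ∀ i, 0 ≤ y i - 1 * z i := fun i => by
      have := hnp i
      have := hy.1.1 i
      linarith
    have h1 := hy.2 _ (dual_feasible_sub hy.1 hAz 1 hnn)
    have h2 := cost_sub b y z 1
    have h3 : ∑ i, (b i : ℝ) * z i = 0 := by linarith
    have h4 := key (fun i => - z i) (fun i hi => by simp [hz i hi])
      (fun j => by simp [Finset.sum_neg_distrib, hAz j])
      (by simp [Finset.sum_neg_distrib, h3])
    funext i
    have := h4 i
    have := hnp i
    simp only [Pi.zero_apply]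
    linarith
  rcases le_total 0 (∑ i, (b i : ℝ) * z i) with h | h
  · exact key2 z hz hAz h
  · have := key2 (fun i => - z i) (fun i hi => by simp [hz i hi])
      (fun j => by simp [Finset.sum_neg_distrib, hAz j])
      (by simp only [mul_neg, Finset.sum_neg_distrib]; linarith)
    funext i
    have := congrFun this i
    simpa using this

/-- If every subdeterminant of the integral matrix `A` belongs to
`{0} ∪ {± p^k : k ≥ 0}` for a prime `p`, then for every integral `b` the system `Ax ≤ b` is
totally dual `p`-adic. -/
theorem padic_matrix_totally_dual_padic {m n : ℕ} (p : ℕ) (hp : p.Prime)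
    (A : Matrix (Fin m) (Fin n) ℤ) (b : Fin m → ℤ)
    (hA : ∀ (r : ℕ) (f : Fin r → Fin m) (g : Fin r → Fin n),
      Function.Injective f → Function.Injective g →
      (A.submatrix f g).det = 0 ∨
        ∃ k : ℕ, (A.submatrix f g).det = (p : ℤ) ^ k ∨
          (A.submatrix f g).det = -((p : ℤ) ^ k)) :
    TotallyDualPadic p A b := by
  rintro w ⟨y0, hy0⟩
  obtain ⟨y, hy, hmin⟩ : ∃ y, DualOptimal A b w y ∧ ∀ y', DualOptimal A b w y' →
      (univ.filter fun i => y i ≠ 0).card ≤ (univ.filter fun i => y' i ≠ 0).card := by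
    have hex : ∃ k, ∃ y, DualOptimal A b w y ∧ (univ.filter fun i => y i ≠ 0).card = k :=
      ⟨_, y0, hy0, rfl⟩
    obtain ⟨y, hy, hk⟩ := Nat.find_spec hex
    refine ⟨y, hy, fun y' hy' => ?_⟩
    rw [hk]
    exact Nat.find_min' hex ⟨y', hy', rfl⟩
  refine ⟨y, hy, ?_⟩
  have hli := min_support hy hmin
  set S := univ.filter fun i => y i ≠ 0 with hS
  set r := S.card with hr
  let e : Fin r ≃ S := S.equivFin.symm
  let f : Fin r → Fin m := fun i => (e i : Fin m)
  have hf : Function.Injective f := fun a c h => e.injective (Subtype.ext h)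
  have hfS : ∀ i, y i ≠ 0 → ∃ a, f a = i := fun i hi =>
    ⟨e.symm ⟨i, by simpa [hS] using hi⟩, by simp [f]⟩
  -- sums over the support
  have hsum : ∀ u : Fin m → ℝ, (∀ i, y i = 0 → u i = 0) → ∑ i, u i = ∑ a, u (f a) := by
    intro u hu
    rw [← Finset.sum_image (s := univ) (g := f) (f := u) (fun a _ c _ h => hf h)]
    symm
    apply Finset.sum_subset (Finset.subset_univ _)
    intro i _ hi
    apply hu
    by_contra hne
    obtain ⟨a, ha⟩ := hfS i hne
    exact hi (Finset.mem_image.mpr ⟨a, mem_univ _, ha⟩)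
  let B : Matrix (Fin r) (Fin n) ℝ := fun a j => (A (f a) j : ℝ)
  have hB : LinearIndependent ℝ B.row := by
    rw [Fintype.linearIndependent_iff]
    intro c hc
    let z : Fin m → ℝ := fun i => if h : ∃ a, f a = i then c h.choose else 0
    have hzf : ∀ a, z (f a) = c a := by
      intro a
      have h : ∃ a', f a' = f a := ⟨a, rfl⟩
      have : z (f a) = c h.choose := dif_pos h
      rw [this, hf h.choose_spec]
    have hz0 : ∀ i, y i = 0 → z i = 0 := by
      intro i hi
      apply dif_neg
      rintro ⟨a, rfl⟩
      have : (e a : Fin m) ∈ S := (e a).2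
      exact (Finset.mem_filter.mp this).2 hi
    have hz := hli z hz0 (fun j => by
      rw [hsum _ (fun i hi => by rw [hz0 i hi, zero_mul])]
      have := congrFun hc j
      simp only [Finset.sum_apply, Pi.smul_apply, smul_eq_mul, Pi.zero_apply] at this
      rw [← this]
      exact Finset.sum_congr rfl fun a _ => by rw [hzf]; rfl)
    intro a
    rw [← hzf, hz]
    rfl
  obtain ⟨g, hg, hdet⟩ := exists_cols_det_ne_zero B hB
  set M := A.submatrix f g with hM
  have hBM : B.submatrix id g = M.map (Int.castRingHom ℝ) := rfl
  have hdetM : (B.submatrix id g).det = (M.det : ℝ) := by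
    rw [hBM]
    exact ((Int.castRingHom ℝ).map_det M).symm
  have hcr : ∀ a, (M.det : ℝ) * y (f a)
      = ((∑ c, w (g c) * M.adjugate c a : ℤ) : ℝ) := by
    intro a
    have h1 : ∀ c, (w (g c) : ℝ) = ∑ a', y (f a') * (M a' c : ℝ) := fun c => by
      rw [← hy.1.2 (g c), hsum _ (fun i hi => by rw [hi, zero_mul])]
      rfl
    have h2 : ∀ a', ∑ c, (M a' c : ℝ) * (M.adjugate c a : ℝ)
        = if a' = a then (M.det : ℝ) else 0 := by
      intro a'
      have := congrFun (congrFun (Matrix.mul_adjugate M) a') a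
      rw [Matrix.mul_apply, Matrix.smul_apply, Matrix.one_apply] at this
      have h3 := congrArg (fun x : ℤ => (x : ℝ)) this
      push_cast at h3
      rw [h3]
      split_ifs <;> simp
    simp_rw [Int.cast_sum, Int.cast_mul, h1, Finset.sum_mul]
    rw [Finset.sum_comm]
    simp_rw [mul_assoc, ← Finset.mul_sum, h2]
    simp only [mul_ite, mul_zero, Finset.sum_ite_eq', mem_univ, if_true]
    ring
  intro i
  by_cases hi : y i = 0
  · exact ⟨0, 0, by simp [hi]⟩
  obtain ⟨a, rfl⟩ := hfS i hi
  have hp0 : (p : ℝ) ≠ 0 := by exact_mod_cast hp.ne_zero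
  have ha := hcr a
  rcases hA r f g hf hg with h | ⟨k, h | h⟩
  · exact absurd (by rw [hdetM, hM, h]; simp) hdet
  · refine ⟨∑ c, w (g c) * M.adjugate c a, k, ?_⟩
    rw [eq_div_iff (pow_ne_zero _ hp0), ← ha, hM, h]
    push_cast
    ring
  · refine ⟨-(∑ c, w (g c) * M.adjugate c a), k, ?_⟩
    rw [eq_div_iff (pow_ne_zero _ hp0), Int.cast_neg, ← ha, hM, h]
    push_cast
    ring
end
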